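/- The functions ξ₂, ξ₃, ξ₄ satisfy Halphen's system of differential equations at every point of ℍ: ξ₂' = ξ₂ξ₃ + ξ₂ξ₄ − ξ₃ξ₄; ξ₃' = ξ₂ξ₃ − ξ₂ξ₄ + ξ₃ξ₄; ξ₄' = −ξ₂ξ₃ + ξ₂ξ₄ + ξ₃ξ₄. -/

import Mathlib

open Complex

noncomputable section

/-- `q = e^{2πiτ}`. -/
def qexp (τ : ℂ) : ℂ := Complex.exp (2 * ↑Real.pi * Complex.I * τ)

/-- `q^s = e^{2πisτ}` for real `s`. -/
def qpow (s : ℝ) (τ : ℂ) : ℂ := Complex.exp (2 * ↑Real.pi * Complex.I * ↑s * τ)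

/-- The differential operator `f' = (1/(2πi)) df/dτ` (i.e. `q d/dq`). -/
def Dq (f : ℂ → ℂ) : ℂ → ℂ := fun τ => deriv f τ / (2 * ↑Real.pi * Complex.I)

/-- The divisor power sum `σ_k(n)`. -/
def sigma' (k n : ℕ) : ℕ := ∑ d ∈ n.divisors, d ^ k

/-- The quasimodular Eisenstein series `E₂`. -/
def E2 (τ : ℂ) : ℂ := 1 - 24 * ∑' n : ℕ, (sigma' 1 (n + 1) : ℂ) * qexp τ ^ (n + 1)

/-- The Eisenstein series `E₄`. -/
def E4 (τ : ℂ) : ℂ := 1 + 240 * ∑' n : ℕ, (sigma' 3 (n + 1) : ℂ) * qexp τ ^ (n + 1)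

/-- The Eisenstein series `E₆`. -/
def E6 (τ : ℂ) : ℂ := 1 - 504 * ∑' n : ℕ, (sigma' 5 (n + 1) : ℂ) * qexp τ ^ (n + 1)

/-- The Dedekind eta function `η(τ) = q^{1/24} ∏ (1 - qⁿ)`. -/
def η (τ : ℂ) : ℂ := qpow (1/24) τ * ∏' n : ℕ, (1 - qexp τ ^ (n + 1))

/-- Theta constant `θ₂(τ) = Σ_{n∈ℤ} q^{(n-1/2)²/2}`. -/
def θ₂ (τ : ℂ) : ℂ := ∑' n : ℤ, qpow (((n : ℝ) - 1/2) ^ 2 / 2) τ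

/-- Theta constant `θ₃(τ) = Σ_{n∈ℤ} q^{n²/2}`. -/
def θ₃ (τ : ℂ) : ℂ := ∑' n : ℤ, qpow ((n : ℝ) ^ 2 / 2) τ

/-- Theta constant `θ₄(τ) = Σ_{n∈ℤ} (-1)ⁿ q^{n²/2}`. -/
def θ₄ (τ : ℂ) : ℂ := ∑' n : ℤ, (-1 : ℂ) ^ n * qpow ((n : ℝ) ^ 2 / 2) τ

/-- `ξ₂ = 2 θ₂'/θ₂`. -/
def ξ₂ : ℂ → ℂ := fun τ => 2 * Dq θ₂ τ / θ₂ τ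

/-- `ξ₃ = 2 θ₃'/θ₃`. -/
def ξ₃ : ℂ → ℂ := fun τ => 2 * Dq θ₃ τ / θ₃ τ

/-- `ξ₄ = 2 θ₄'/θ₄`. -/
def ξ₄ : ℂ → ℂ := fun τ => 2 * Dq θ₄ τ / θ₄ τ

/-- `h₀ = 4ξ₂ - 2ξ₃ - 2ξ₄` (equal to `η⁴ χ_{Λ₀}^{q}`). -/
def h₀ : ℂ → ℂ := fun τ => 4 * ξ₂ τ - 2 * ξ₃ τ - 2 * ξ₄ τ

/-- `h₁ = 2ξ₃ - 2ξ₄` (equal to `η⁴ χ_{Λ₁}^{q}`). -/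
def h₁ : ℂ → ℂ := fun τ => 2 * ξ₃ τ - 2 * ξ₄ τ

/-- The Serre-type derivative `∂_k f = f' - (k/12) E₂ f`. -/
def partialD (k : ℂ) (f : ℂ → ℂ) : ℂ → ℂ := fun τ => Dq f τ - k / 12 * E2 τ * f τ

end

section

open Filter Topology MatrixGroups ModularForm
open UpperHalfPlane hiding I

/-- A holomorphic function on the upper half-plane, with the transformation behaviour of a level
one form of weight `k` and vanishing at `i∞`, is a cusp form. -/
lemma exists_cuspForm_eq {k : ℤ} {f : ℂ → ℂ}
    (hd : ∀ τ : ℂ, 0 < τ.im → DifferentiableAt ℂ f τ)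
    (hT : ∀ τ : ℂ, 0 < τ.im → f (τ + 1) = f τ)
    (hS : ∀ τ : ℂ, 0 < τ.im → f (-1 / τ) = τ ^ k * f τ)
    (h0 : Tendsto (fun τ : ℍ ↦ f τ) atImInfty (𝓝 0)) :
    ∃ F : CuspForm 𝒮ℒ k, ∀ τ : ℍ, F τ = f τ := by
  have hT' : ((fun τ : ℍ ↦ f τ) ∣[k] ModularGroup.T) = fun τ : ℍ ↦ f τ := by
    ext z
    rw [ModularForm.SL_slash_apply, ModularGroup.denom_apply, modular_T_smul]
    simpa [add_comm, ModularGroup.T] using hT z z.2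
  have hS' : ((fun τ : ℍ ↦ f τ) ∣[k] ModularGroup.S) = fun τ : ℍ ↦ f τ := by
    ext z
    rw [ModularForm.SL_slash_apply, ModularGroup.denom_S, modular_S_smul]
    have := hS z z.2
    have hz : (z : ℂ) ^ k ≠ 0 := zpow_ne_zero _ z.ne_zero
    rw [neg_div, one_div] at this
    simp only [inv_neg, this, zpow_neg]
    field_simp
  exact ⟨{
    toFun := fun τ ↦ f τ
    slash_action_eq' := by
      rintro _ ⟨A, rfl⟩
      exact SlashInvariantForm.slash_action_generators_SL2Z hS' hT' A
    holo' := by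
      rw [UpperHalfPlane.mdifferentiable_iff]
      refine DifferentiableOn.congr (f := f)
        (fun z hz ↦ (hd z hz).differentiableWithinAt) fun z hz ↦ ?_
      simp [ofComplex_apply_of_im_pos hz]
    zero_at_cusps' := fun hc ↦ by
      rw [Subgroup.IsArithmetic.isCusp_iff_isCusp_SL2Z] at hc
      rw [OnePoint.isZeroAt_iff_forall_SL2Z hc]
      intro γ _
      rw [SlashInvariantForm.slash_action_generators_SL2Z hS' hT']
      exact h0 }, fun τ ↦ rfl⟩

/-- The nome `e^{πiτ}`, a square root of `q`. -/
noncomputable def nome (τ : ℂ) : ℂ := cexp (Real.pi * I * τ)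

lemma tendsto_nome_atImInfty :
    Tendsto (fun τ : ℍ ↦ nome τ) atImInfty (𝓝 0) := by
  have h := (qParam_tendsto_atImInfty (h := 2) two_pos)
  refine h.congr fun τ ↦ ?_
  simp only [Function.Periodic.qParam, nome]
  congr 1
  push_cast
  ring

/-- If `f` has the properties of a level one cusp form of weight less than `12`, then `f = 0`. -/
lemma eq_zero_of_levelOne_of_weight_lt_twelve {k : ℤ} (hk : k < 12) {f : ℂ → ℂ}
    (hd : ∀ τ : ℂ, 0 < τ.im → DifferentiableAt ℂ f τ)
    (hT : ∀ τ : ℂ, 0 < τ.im → f (τ + 1) = f τ)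
    (hS : ∀ τ : ℂ, 0 < τ.im → f (-1 / τ) = τ ^ k * f τ)
    (h0 : Tendsto (fun τ : ℍ ↦ f τ) atImInfty (𝓝 0)) {τ : ℂ} (hτ : 0 < τ.im) : f τ = 0 := by
  obtain ⟨F, hF⟩ := exists_cuspForm_eq hd hT hS h0
  have h := rank_zero_iff_forall_zero.mp (CuspForm.rank_eq_zero_of_weight_lt_twelve hk) F
  rw [← hF ⟨τ, hτ⟩, h]
  rfl

/-- A level one cusp form `f` of weight `12` is `c * Δ`, where `c` is the limit of `f / q`. -/
lemma eq_smul_discriminant_of_levelOne {f : ℂ → ℂ}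
    (hd : ∀ τ : ℂ, 0 < τ.im → DifferentiableAt ℂ f τ)
    (hT : ∀ τ : ℂ, 0 < τ.im → f (τ + 1) = f τ)
    (hS : ∀ τ : ℂ, 0 < τ.im → f (-1 / τ) = τ ^ 12 * f τ)
    {φ : ℂ → ℂ} (hφ : ContinuousAt φ 0)
    (hf : ∀ τ : ℂ, 0 < τ.im →
      f τ = nome τ ^ 2 * φ (nome τ)) (τ : ℍ) :
    f τ = φ 0 * ModularForm.discriminant τ := by
  have hx := tendsto_nome_atImInfty
  have hφx := hφ.tendsto.comp hx
  have h0 : Tendsto (fun τ : ℍ ↦ f τ) atImInfty (𝓝 0) := by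
    have := (hx.pow 2).mul hφx
    rw [zero_pow two_ne_zero, zero_mul] at this
    exact this.congr fun τ ↦ (hf τ τ.2).symm
  obtain ⟨F, hF⟩ := exists_cuspForm_eq (k := 12) hd hT (by exact_mod_cast hS) h0
  obtain ⟨c, hc⟩ := CuspForm.exists_smul_discriminant_of_weight_eq_twelve F
  have hfc (τ : ℍ) : f τ = c * ModularForm.discriminant τ := by
    rw [← hF, ← hc]; rfl
  have hlim := ModularForm.tendsto_atImInfty_tprod_one_sub_eta_q_pow.const_mul c
  have : φ 0 = c * 1 := by
    refine tendsto_nhds_unique hφx (hlim.congr fun τ ↦ ?_)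
    have h1 := hfc τ
    have hq : Function.Periodic.qParam 1 (τ : ℂ) = nome τ ^ 2 := by
      rw [nome, ← Complex.exp_nat_mul, Function.Periodic.qParam]
      congr 1
      push_cast
      ring
    rw [hf τ τ.2, ModularForm.discriminant_eq_q_prod, hq] at h1
    have hne : nome τ ^ 2 ≠ 0 := pow_ne_zero _ (exp_ne_zero _)
    refine mul_left_cancel₀ hne ?_
    simp only [Function.comp_apply]
    rw [h1]
    ring
  rw [hfc, this, mul_one]

/-- The series `∑ c n * x ^ e n` over the integers. -/
noncomputable def lacunarySeries (c : ℤ → ℂ) (e : ℤ → ℕ) (x : ℂ) : ℂ := ∑' n : ℤ, c n * x ^ e n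

lemma differentiableOn_lacunarySeries {c : ℤ → ℂ} {e : ℤ → ℕ} (hc : ∀ n, ‖c n‖ ≤ 1)
    (he : ∀ n, n.natAbs ≤ e n + 1) :
    DifferentiableOn ℂ (lacunarySeries c e) (Metric.ball 0 1) := by
  intro x hx
  obtain ⟨r, hxr, hr1⟩ := exists_between (mem_ball_zero_iff.mp hx)
  have hr0 : 0 < r := (norm_nonneg x).trans_lt hxr
  have hsum : Summable fun n : ℤ ↦ r⁻¹ * r ^ n.natAbs := by
    refine Summable.mul_left _ (Summable.of_nat_of_neg ?_ ?_) <;>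
      simpa using summable_geometric_of_lt_one hr0.le hr1
  have hball : DifferentiableOn ℂ (lacunarySeries c e) (Metric.ball 0 r) := by
    refine differentiableOn_tsum_of_summable_norm hsum (fun n ↦ by fun_prop) Metric.isOpen_ball
      fun n w hw ↦ ?_
    rw [norm_mul, norm_pow]
    have hw' : ‖w‖ ≤ r := (mem_ball_zero_iff.mp hw).le
    calc ‖c n‖ * ‖w‖ ^ e n ≤ 1 * r ^ e n := by gcongr; exact hc n
      _ = r⁻¹ * r ^ (e n + 1) := by field_simp; ring
      _ ≤ r⁻¹ * r ^ n.natAbs :=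
        mul_le_mul_of_nonneg_left (pow_le_pow_of_le_one hr0.le hr1.le (he n)) (by positivity)
  exact (hball.differentiableAt
    (Metric.isOpen_ball.mem_nhds (mem_ball_zero_iff.mpr hxr))).differentiableWithinAt

lemma nome_mem_ball {τ : ℂ} (hτ : 0 < τ.im) : nome τ ∈ Metric.ball (0 : ℂ) 1 := by
  rw [mem_ball_zero_iff, nome, Complex.norm_exp, Real.exp_lt_one_iff]
  simpa using mul_pos Real.pi_pos hτ

lemma nome_add_one (τ : ℂ) : nome (τ + 1) = -nome τ := by
  rw [nome, mul_add, Complex.exp_add, mul_one, Complex.exp_pi_mul_I, mul_neg_one, nome]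

lemma hasDerivAt_nome (τ : ℂ) : HasDerivAt nome (Real.pi * I * nome τ) τ := by
  have h := ((hasDerivAt_id τ).const_mul (Real.pi * I)).cexp
  exact h.congr_deriv (by simp only [id, nome]; ring)

/-- `θ₂ = q^{1/8} θ₂Series(q^{1/2})`. -/
noncomputable def θ₂Series : ℂ → ℂ := lacunarySeries (fun _ ↦ 1) fun n ↦ (n ^ 2 - n).natAbs

/-- `θ₃ = θ₃Series(q^{1/2})`. -/
noncomputable def θ₃Series : ℂ → ℂ := lacunarySeries (fun _ ↦ 1) fun n ↦ n.natAbs ^ 2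

lemma differentiableOn_θ₂Series : DifferentiableOn ℂ θ₂Series (Metric.ball 0 1) := by
  refine differentiableOn_lacunarySeries (by simp) fun n ↦ ?_
  zify
  rcases abs_cases n with h | h <;> rcases abs_cases (n ^ 2 - n) with h' | h' <;> nlinarith

lemma differentiableOn_θ₃Series : DifferentiableOn ℂ θ₃Series (Metric.ball 0 1) :=
  differentiableOn_lacunarySeries (by simp) fun n ↦ by nlinarith

lemma θ₂Series_zero : θ₂Series 0 = 2 := by
  rw [θ₂Series, lacunarySeries, tsum_eq_sum (s := {0, 1})]
  · simp; norm_num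
  · intro n hn
    have h : (n ^ 2 - n).natAbs ≠ 0 := by
      rw [Int.natAbs_ne_zero, sq, ← mul_sub_one]
      simp only [Finset.mem_insert, Finset.mem_singleton, not_or] at hn
      exact mul_ne_zero hn.1 (sub_ne_zero.mpr hn.2)
    simp [h]

lemma θ₃Series_zero : θ₃Series 0 = 1 := by
  rw [θ₃Series, lacunarySeries, tsum_eq_single 0]
  · simp
  · intro n hn
    simp [hn]

lemma θ₂Series_neg (x : ℂ) : θ₂Series (-x) = θ₂Series x := by
  refine tsum_congr fun n ↦ ?_
  rw [Even.neg_pow]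
  rw [Int.natAbs_even, sq]
  exact Int.even_mul_pred_self n |> fun h ↦ by rwa [mul_sub_one] at h

lemma θ₂_eq (τ : ℂ) : θ₂ τ = cexp (Real.pi * I * τ / 4) * θ₂Series (nome τ) := by
  rw [θ₂, θ₂Series, lacunarySeries, ← tsum_mul_left]
  refine tsum_congr fun n ↦ ?_
  rw [one_mul, nome, ← Complex.exp_nat_mul, ← Complex.exp_add, qpow]
  have h : (((n ^ 2 - n).natAbs : ℕ) : ℂ) = (n : ℂ) ^ 2 - n := by
    rw [← Int.cast_natCast, Int.natCast_natAbs, abs_of_nonneg (by nlinarith [Int.le_self_sq n])]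
    push_cast; ring
  rw [h]
  congr 1
  push_cast
  ring

lemma θ₃_eq (τ : ℂ) : θ₃ τ = θ₃Series (nome τ) := by
  refine tsum_congr fun n ↦ ?_
  rw [one_mul, nome, ← Complex.exp_nat_mul, qpow]
  have h : ((n.natAbs ^ 2 : ℕ) : ℂ) = (n : ℂ) ^ 2 := by
    rw [← Int.cast_natCast, Nat.cast_pow, Int.natCast_natAbs, sq_abs, Int.cast_pow]
  rw [h]
  congr 1
  push_cast
  ring

lemma θ₄_eq (τ : ℂ) : θ₄ τ = θ₃Series (-nome τ) := by
  refine tsum_congr fun n ↦ ?_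
  rw [one_mul, neg_pow, nome, ← Complex.exp_nat_mul, qpow]
  have h : ((n.natAbs ^ 2 : ℕ) : ℂ) = (n : ℂ) ^ 2 := by
    rw [← Int.cast_natCast, Nat.cast_pow, Int.natCast_natAbs, sq_abs, Int.cast_pow]
  have h' : (-1 : ℂ) ^ n = (-1) ^ (n.natAbs ^ 2) := by
    rcases Int.even_or_odd n with hn | hn
    · rw [hn.neg_one_zpow, ((Int.natAbs_even.mpr hn).pow_of_ne_zero two_ne_zero).neg_one_pow]
    · rw [hn.neg_one_zpow, ((Int.natAbs_odd.mpr hn).pow).neg_one_pow]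
  rw [h, h']
  congr 2
  push_cast
  ring

lemma θ₂_add_one (τ : ℂ) : θ₂ (τ + 1) = cexp (Real.pi * I / 4) * θ₂ τ := by
  rw [θ₂_eq, θ₂_eq, nome_add_one, θ₂Series_neg, ← mul_assoc, ← Complex.exp_add]
  congr 2
  ring

lemma θ₃_add_one (τ : ℂ) : θ₃ (τ + 1) = θ₄ τ := by
  rw [θ₃_eq, θ₄_eq, nome_add_one]

lemma θ₄_add_one (τ : ℂ) : θ₄ (τ + 1) = θ₃ τ := by
  rw [θ₃_eq, θ₄_eq, nome_add_one, neg_neg]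

lemma θ₂_eq_jacobiTheta₂ (τ : ℂ) :
    θ₂ τ = cexp (Real.pi * I * τ / 4) * jacobiTheta₂ (τ / 2) τ := by
  rw [← jacobiTheta₂_neg_left, θ₂, jacobiTheta₂, ← tsum_mul_left]
  refine tsum_congr fun n ↦ ?_
  rw [jacobiTheta₂_term, ← Complex.exp_add, qpow]
  congr 1
  push_cast
  ring

lemma θ₃_eq_jacobiTheta₂ (τ : ℂ) : θ₃ τ = jacobiTheta₂ 0 τ := by
  refine tsum_congr fun n ↦ ?_
  rw [jacobiTheta₂_term, qpow]
  congr 1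
  push_cast
  ring

lemma θ₄_eq_jacobiTheta₂ (τ : ℂ) : θ₄ τ = jacobiTheta₂ (1 / 2) τ := by
  refine tsum_congr fun n ↦ ?_
  rw [jacobiTheta₂_term, qpow, ← Complex.exp_pi_mul_I, ← Complex.exp_int_mul, ← Complex.exp_add]
  congr 1
  push_cast
  ring

/-- The automorphy factor `√(-iτ)` of the theta constants. -/
noncomputable def thetaFactor (τ : ℂ) : ℂ := (-I * τ) ^ (1 / 2 : ℂ)

lemma neg_I_mul_mem_slitPlane {τ : ℂ} (hτ : 0 < τ.im) : -I * τ ∈ slitPlane := by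
  left; simpa using hτ

lemma ne_zero_of_im_pos {τ : ℂ} (hτ : 0 < τ.im) : τ ≠ 0 := by
  rintro rfl; simp at hτ

lemma neg_one_div_im_pos {τ : ℂ} (hτ : 0 < τ.im) : 0 < (-1 / τ).im := by
  rw [neg_div, one_div, ← inv_neg]
  simpa using UpperHalfPlane.im_inv_neg_coe_pos ⟨τ, hτ⟩

lemma thetaFactor_ne_zero {τ : ℂ} (hτ : 0 < τ.im) : thetaFactor τ ≠ 0 := by
  rw [thetaFactor, Complex.cpow_ne_zero_iff]
  exact .inl (slitPlane_ne_zero (neg_I_mul_mem_slitPlane hτ))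

lemma thetaFactor_sq (τ : ℂ) : thetaFactor τ ^ 2 = -I * τ := by
  rw [thetaFactor, one_div]
  exact Complex.cpow_ofNat_inv_pow _ 2

lemma thetaFactor_pow_eight (τ : ℂ) : thetaFactor τ ^ 8 = τ ^ 4 := by
  rw [show 8 = 2 * 4 by norm_num, pow_mul, thetaFactor_sq, mul_pow, Even.neg_pow ⟨2, rfl⟩,
    I_pow_four, one_mul]

lemma hasDerivAt_thetaFactor {τ : ℂ} (hτ : 0 < τ.im) :
    HasDerivAt thetaFactor (thetaFactor τ / (2 * τ)) τ := by
  have hne : -I * τ ≠ 0 := slitPlane_ne_zero (neg_I_mul_mem_slitPlane hτ)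
  have h := ((hasDerivAt_id τ).const_mul (-I)).cpow_const (c := 1 / 2)
    (neg_I_mul_mem_slitPlane hτ)
  refine h.congr_deriv ?_
  have hτ0 := ne_zero_of_im_pos hτ
  rw [id, Complex.cpow_sub _ _ hne, Complex.cpow_one, thetaFactor]
  field_simp

lemma θ₃_neg_one_div {τ : ℂ} (hτ : 0 < τ.im) : θ₃ (-1 / τ) = thetaFactor τ * θ₃ τ := by
  have h := jacobiTheta₂_functional_equation 0 τ
  have h1 := thetaFactor_ne_zero hτ
  rw [θ₃_eq_jacobiTheta₂, θ₃_eq_jacobiTheta₂, h]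
  rw [← thetaFactor]
  simp only [zero_div, ne_eq, OfNat.ofNat_ne_zero, not_false_eq_true, zero_pow, mul_zero,
    Complex.exp_zero, mul_one]
  field_simp

lemma θ₂_neg_one_div {τ : ℂ} (hτ : 0 < τ.im) : θ₂ (-1 / τ) = thetaFactor τ * θ₄ τ := by
  have h := jacobiTheta₂_functional_equation (1 / 2) τ
  have h1 := thetaFactor_ne_zero hτ
  rw [θ₂_eq_jacobiTheta₂, θ₄_eq_jacobiTheta₂, h, ← jacobiTheta₂_neg_left (-1 / τ / 2)]
  rw [← thetaFactor, show -(-1 / τ / 2) = 1 / 2 / τ by ring,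
    show Real.pi * I * (-1 / τ) / 4 = -Real.pi * I * (1 / 2) ^ 2 / τ by ring]
  field_simp

lemma θ₄_neg_one_div {τ : ℂ} (hτ : 0 < τ.im) : θ₄ (-1 / τ) = thetaFactor τ * θ₂ τ := by
  have h := jacobiTheta₂_functional_equation (τ / 2) τ
  have h1 := thetaFactor_ne_zero hτ
  have hτ0 := ne_zero_of_im_pos hτ
  rw [θ₂_eq_jacobiTheta₂, θ₄_eq_jacobiTheta₂, h, ← thetaFactor,
    show τ / 2 / τ = 1 / 2 by field_simp,
    show -Real.pi * I * (τ / 2) ^ 2 / τ = -(Real.pi * I * τ / 4) by field_simp; ring,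
    Complex.exp_neg]
  have h2 := Complex.exp_ne_zero (Real.pi * I * τ / 4)
  field_simp

lemma differentiableAt_θ₃Series_nome {τ : ℂ} (hτ : 0 < τ.im) :
    DifferentiableAt ℂ θ₃Series (nome τ) :=
  differentiableOn_θ₃Series.differentiableAt (Metric.isOpen_ball.mem_nhds (nome_mem_ball hτ))

lemma differentiableAt_θ₂ {τ : ℂ} (hτ : 0 < τ.im) : DifferentiableAt ℂ θ₂ τ := by
  have h : DifferentiableAt ℂ θ₂Series (nome τ) :=
    differentiableOn_θ₂Series.differentiableAt (Metric.isOpen_ball.mem_nhds (nome_mem_ball hτ))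
  rw [funext θ₂_eq]
  exact DifferentiableAt.mul (by fun_prop) (h.comp τ (hasDerivAt_nome τ).differentiableAt)

lemma differentiableAt_θ₃ {τ : ℂ} (hτ : 0 < τ.im) : DifferentiableAt ℂ θ₃ τ := by
  rw [funext θ₃_eq]
  exact (differentiableAt_θ₃Series_nome hτ).comp τ (hasDerivAt_nome τ).differentiableAt

lemma differentiableAt_θ₄ {τ : ℂ} (hτ : 0 < τ.im) : DifferentiableAt ℂ θ₄ τ := by
  rw [← funext θ₃_add_one]
  exact (differentiableAt_θ₃ (τ := τ + 1) (by simpa using hτ)).comp τ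
    (differentiableAt_id.add_const 1)

lemma continuousAt_zero_θ₂Series : ContinuousAt θ₂Series 0 :=
  differentiableOn_θ₂Series.continuousOn.continuousAt (Metric.ball_mem_nhds 0 one_pos)

lemma continuousAt_zero_θ₃Series : ContinuousAt θ₃Series 0 :=
  differentiableOn_θ₃Series.continuousOn.continuousAt (Metric.ball_mem_nhds 0 one_pos)

/-- The product of the theta constants satisfies `(θ₂ θ₃ θ₄)⁸ = 2⁸ Δ`. -/
lemma theta_mul_pow_eight_eq_discriminant (τ : ℍ) :
    (θ₂ τ * θ₃ τ * θ₄ τ) ^ 8 = 2 ^ 8 * ModularForm.discriminant τ := by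
  have h := eq_smul_discriminant_of_levelOne (f := fun τ ↦ (θ₂ τ * θ₃ τ * θ₄ τ) ^ 8)
    (φ := fun x ↦ (θ₂Series x * θ₃Series x * θ₃Series (-x)) ^ 8) ?_ ?_ ?_ ?_ ?_ τ
  · simpa [θ₂Series_zero, θ₃Series_zero] using h
  · exact fun τ hτ ↦ (((differentiableAt_θ₂ hτ).mul (differentiableAt_θ₃ hτ)).mul
      (differentiableAt_θ₄ hτ)).pow 8
  · intro τ hτ
    have : cexp (Real.pi * I / 4) ^ 8 = 1 := by
      rw [← Complex.exp_nat_mul, ← Complex.exp_two_pi_mul_I]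
      congr 1; push_cast; ring
    simp only [θ₂_add_one, θ₃_add_one, θ₄_add_one, mul_pow, this]
    ring
  · intro τ hτ
    simp only [θ₂_neg_one_div hτ, θ₃_neg_one_div hτ, θ₄_neg_one_div hτ, mul_pow,
      thetaFactor_pow_eight]
    ring
  · have hneg : ContinuousAt (fun x ↦ θ₃Series (-x)) 0 :=
      ContinuousAt.comp (by rw [neg_zero]; exact continuousAt_zero_θ₃Series) continuous_neg.continuousAt
    exact ((continuousAt_zero_θ₂Series.mul continuousAt_zero_θ₃Series).mul hneg).pow 8
  · intro τ hτ
    simp only [θ₂_eq, θ₃_eq, θ₄_eq, mul_pow]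
    have : cexp (Real.pi * I * τ / 4) ^ 8 = nome τ ^ 2 := by
      rw [nome, ← Complex.exp_nat_mul, ← Complex.exp_nat_mul]
      congr 1; push_cast; ring
    rw [this]
    ring

lemma theta_mul_ne_zero {τ : ℂ} (hτ : 0 < τ.im) : θ₂ τ * θ₃ τ * θ₄ τ ≠ 0 := by
  intro h
  have := theta_mul_pow_eight_eq_discriminant ⟨τ, hτ⟩
  rw [h, zero_pow (by norm_num)] at this
  exact mul_ne_zero (by norm_num) (ModularForm.discriminant_ne_zero _) this.symm

lemma θ₂_ne_zero {τ : ℂ} (hτ : 0 < τ.im) : θ₂ τ ≠ 0 :=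
  left_ne_zero_of_mul (left_ne_zero_of_mul (theta_mul_ne_zero hτ))

lemma θ₃_ne_zero {τ : ℂ} (hτ : 0 < τ.im) : θ₃ τ ≠ 0 :=
  right_ne_zero_of_mul (left_ne_zero_of_mul (theta_mul_ne_zero hτ))

lemma θ₄_ne_zero {τ : ℂ} (hτ : 0 < τ.im) : θ₄ τ ≠ 0 :=
  right_ne_zero_of_mul (theta_mul_ne_zero hτ)

lemma isOpen_im_pos : IsOpen {τ : ℂ | 0 < τ.im} := isOpen_lt continuous_const Complex.continuous_im

lemma eventually_im_pos {τ : ℂ} (hτ : 0 < τ.im) : ∀ᶠ t in 𝓝 τ, 0 < t.im :=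
  isOpen_im_pos.mem_nhds hτ

lemma differentiableAt_Dq {f : ℂ → ℂ} (hf : ∀ τ : ℂ, 0 < τ.im → DifferentiableAt ℂ f τ)
    {τ : ℂ} (hτ : 0 < τ.im) : DifferentiableAt ℂ (Dq f) τ := by
  have h : DifferentiableOn ℂ f {τ : ℂ | 0 < τ.im} :=
    fun t ht ↦ (hf t ht).differentiableWithinAt
  exact ((h.deriv isOpen_im_pos).differentiableAt (isOpen_im_pos.mem_nhds hτ)).div_const _

lemma differentiableAt_ξ₂ {τ : ℂ} (hτ : 0 < τ.im) : DifferentiableAt ℂ ξ₂ τ :=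
  ((differentiableAt_Dq (fun _ ↦ differentiableAt_θ₂) hτ).const_mul 2).div
    (differentiableAt_θ₂ hτ) (θ₂_ne_zero hτ)

lemma differentiableAt_ξ₃ {τ : ℂ} (hτ : 0 < τ.im) : DifferentiableAt ℂ ξ₃ τ :=
  ((differentiableAt_Dq (fun _ ↦ differentiableAt_θ₃) hτ).const_mul 2).div
    (differentiableAt_θ₃ hτ) (θ₃_ne_zero hτ)

lemma differentiableAt_ξ₄ {τ : ℂ} (hτ : 0 < τ.im) : DifferentiableAt ℂ ξ₄ τ :=
  ((differentiableAt_Dq (fun _ ↦ differentiableAt_θ₄) hτ).const_mul 2).div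
    (differentiableAt_θ₄ hτ) (θ₄_ne_zero hτ)

lemma Dq_add_one {f g : ℂ → ℂ} (h : ∀ τ, f (τ + 1) = g τ) (τ : ℂ) :
    Dq f (τ + 1) = Dq g τ := by
  rw [Dq, Dq, ← funext h, deriv_comp_add_const]

lemma ξ₂_add_one (τ : ℂ) : ξ₂ (τ + 1) = ξ₂ τ := by
  have h : Dq (fun t ↦ cexp (Real.pi * I / 4) * θ₂ t) τ = cexp (Real.pi * I / 4) * Dq θ₂ τ := by
    simp only [Dq, deriv_const_mul_field, mul_div_assoc]
  rw [ξ₂, Dq_add_one θ₂_add_one, h, θ₂_add_one, mul_left_comm,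
    mul_div_mul_left _ _ (Complex.exp_ne_zero _), ξ₂]

lemma ξ₃_add_one (τ : ℂ) : ξ₃ (τ + 1) = ξ₄ τ := by
  rw [ξ₃, ξ₄, Dq_add_one θ₃_add_one, θ₃_add_one]

lemma ξ₄_add_one (τ : ℂ) : ξ₄ (τ + 1) = ξ₃ τ := by
  rw [ξ₃, ξ₄, Dq_add_one θ₄_add_one, θ₄_add_one]

lemma hasDerivAt_comp_neg_one_div {f : ℂ → ℂ}
    (hf : ∀ τ : ℂ, 0 < τ.im → DifferentiableAt ℂ f τ) {τ : ℂ} (hτ : 0 < τ.im) :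
    HasDerivAt (fun t ↦ f (-1 / t)) (2 * Real.pi * I * Dq f (-1 / τ) / τ ^ 2) τ := by
  have hτ0 := ne_zero_of_im_pos hτ
  have h : HasDerivAt (fun t : ℂ ↦ -1 / t) (1 / τ ^ 2) τ := by
    simpa [neg_div] using (hasDerivAt_inv hτ0).fun_neg
  refine ((hf _ (neg_one_div_im_pos hτ)).hasDerivAt.comp τ h).congr_deriv ?_
  rw [Dq]
  have := Complex.two_pi_I_ne_zero
  field_simp

lemma hasDerivAt_of_differentiableAt_Dq {f : ℂ → ℂ} {τ : ℂ} (hf : DifferentiableAt ℂ f τ) :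
    HasDerivAt f (2 * Real.pi * I * Dq f τ) τ := by
  refine hf.hasDerivAt.congr_deriv ?_
  rw [Dq, mul_div_cancel₀ _ Complex.two_pi_I_ne_zero]

/-- Twice the logarithmic derivative of a form of weight `1/2` is quasimodular of weight `2`. -/
lemma two_mul_Dq_div_neg_one_div {f g : ℂ → ℂ}
    (hf : ∀ τ : ℂ, 0 < τ.im → DifferentiableAt ℂ f τ)
    (hg : ∀ τ : ℂ, 0 < τ.im → DifferentiableAt ℂ g τ) (hg0 : ∀ τ : ℂ, 0 < τ.im → g τ ≠ 0)
    (h : ∀ τ : ℂ, 0 < τ.im → f (-1 / τ) = thetaFactor τ * g τ) {τ : ℂ} (hτ : 0 < τ.im) :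
    2 * Dq f (-1 / τ) / f (-1 / τ) = τ ^ 2 * (2 * Dq g τ / g τ) + τ / (2 * Real.pi * I) := by
  have h1 := hasDerivAt_comp_neg_one_div hf hτ
  have h2 := (hasDerivAt_thetaFactor hτ).mul (hasDerivAt_of_differentiableAt_Dq (hg τ hτ))
  have h3 := h1.unique (h2.congr_of_eventuallyEq ((eventually_im_pos hτ).mono h))
  have hτ0 := ne_zero_of_im_pos hτ
  have hθ := thetaFactor_ne_zero hτ
  have hgτ := hg0 τ hτ
  have hpi := Complex.two_pi_I_ne_zero
  rw [h τ hτ]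
  generalize (2 * Real.pi * I : ℂ) = p at *
  generalize Dq f (-1 / τ) = F at *
  have hF : F = τ ^ 2 / p *
      (thetaFactor τ / (2 * τ) * g τ + thetaFactor τ * (p * Dq g τ)) := by
    rw [← h3]; field_simp
  rw [hF]
  field_simp
  ring

lemma ξ₂_neg_one_div {τ : ℂ} (hτ : 0 < τ.im) :
    ξ₂ (-1 / τ) = τ ^ 2 * ξ₄ τ + τ / (2 * Real.pi * I) :=
  two_mul_Dq_div_neg_one_div (fun _ ↦ differentiableAt_θ₂) (fun _ ↦ differentiableAt_θ₄)
    (fun _ ↦ θ₄_ne_zero) (fun _ ↦ θ₂_neg_one_div) hτ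

lemma ξ₃_neg_one_div {τ : ℂ} (hτ : 0 < τ.im) :
    ξ₃ (-1 / τ) = τ ^ 2 * ξ₃ τ + τ / (2 * Real.pi * I) :=
  two_mul_Dq_div_neg_one_div (fun _ ↦ differentiableAt_θ₃) (fun _ ↦ differentiableAt_θ₃)
    (fun _ ↦ θ₃_ne_zero) (fun _ ↦ θ₃_neg_one_div) hτ

lemma ξ₄_neg_one_div {τ : ℂ} (hτ : 0 < τ.im) :
    ξ₄ (-1 / τ) = τ ^ 2 * ξ₂ τ + τ / (2 * Real.pi * I) :=
  two_mul_Dq_div_neg_one_div (fun _ ↦ differentiableAt_θ₄) (fun _ ↦ differentiableAt_θ₂)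
    (fun _ ↦ θ₂_ne_zero) (fun _ ↦ θ₄_neg_one_div) hτ

/-- The failure `a' - (ab + ac - bc)` of an equation of Halphen's system. -/
noncomputable def halphenDefect (a b c : ℂ → ℂ) (τ : ℂ) : ℂ :=
  Dq a τ - (a τ * b τ + a τ * c τ - b τ * c τ)

lemma halphenDefect_comm (a b c : ℂ → ℂ) (τ : ℂ) :
    halphenDefect a b c τ = halphenDefect a c b τ := by
  simp only [halphenDefect]; ring

lemma differentiableAt_halphenDefect {a b c : ℂ → ℂ}
    (ha : ∀ τ : ℂ, 0 < τ.im → DifferentiableAt ℂ a τ)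
    (hb : ∀ τ : ℂ, 0 < τ.im → DifferentiableAt ℂ b τ)
    (hc : ∀ τ : ℂ, 0 < τ.im → DifferentiableAt ℂ c τ) {τ : ℂ} (hτ : 0 < τ.im) :
    DifferentiableAt ℂ (halphenDefect a b c) τ :=
  (differentiableAt_Dq ha hτ).sub ((((ha τ hτ).mul (hb τ hτ)).add ((ha τ hτ).mul (hc τ hτ))).sub
    ((hb τ hτ).mul (hc τ hτ)))

lemma halphenDefect_add_one {a b c a' b' c' : ℂ → ℂ} (ha : ∀ τ, a (τ + 1) = a' τ)
    (hb : ∀ τ, b (τ + 1) = b' τ) (hc : ∀ τ, c (τ + 1) = c' τ) (τ : ℂ) :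
    halphenDefect a b c (τ + 1) = halphenDefect a' b' c' τ := by
  rw [halphenDefect, halphenDefect, Dq_add_one ha, ha, hb, hc]

lemma halphenDefect_neg_one_div {a b c a' b' c' : ℂ → ℂ}
    (ha : ∀ τ : ℂ, 0 < τ.im → a (-1 / τ) = τ ^ 2 * a' τ + τ / (2 * Real.pi * I))
    (hb : ∀ τ : ℂ, 0 < τ.im → b (-1 / τ) = τ ^ 2 * b' τ + τ / (2 * Real.pi * I))
    (hc : ∀ τ : ℂ, 0 < τ.im → c (-1 / τ) = τ ^ 2 * c' τ + τ / (2 * Real.pi * I))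
    (hda : ∀ τ : ℂ, 0 < τ.im → DifferentiableAt ℂ a τ)
    (hda' : ∀ τ : ℂ, 0 < τ.im → DifferentiableAt ℂ a' τ) {τ : ℂ} (hτ : 0 < τ.im) :
    halphenDefect a b c (-1 / τ) = τ ^ 4 * halphenDefect a' b' c' τ := by
  have h1 := hasDerivAt_comp_neg_one_div hda hτ
  have h2 := ((hasDerivAt_pow 2 τ).mul (hasDerivAt_of_differentiableAt_Dq (hda' τ hτ))).add
    ((hasDerivAt_id τ).div_const (2 * Real.pi * I))
  have h3 := h1.unique (h2.congr_of_eventuallyEq ((eventually_im_pos hτ).mono ha))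
  have hτ0 := ne_zero_of_im_pos hτ
  have hpi := Complex.two_pi_I_ne_zero
  rw [halphenDefect, halphenDefect, ha τ hτ, hb τ hτ, hc τ hτ]
  generalize (2 * Real.pi * I : ℂ) = p at *
  generalize Dq a (-1 / τ) = F at *
  have hF : F = τ ^ 2 / p * (2 * τ * a' τ + τ ^ 2 * (p * Dq a' τ) + 1 / p) := by
    have h4 : p * F / τ ^ 2 = 2 * τ * a' τ + τ ^ 2 * (p * Dq a' τ) + 1 / p := by simpa using h3
    rw [← h4]; field_simp
  rw [hF]
  field_simp
  ring

/-- `ξ₂` as a function of the nome. -/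
noncomputable def ξ₂Nome (x : ℂ) : ℂ := 1 / 4 + x * deriv θ₂Series x / θ₂Series x

/-- `ξ₃` as a function of the nome. -/
noncomputable def ξ₃Nome (x : ℂ) : ℂ := x * deriv θ₃Series x / θ₃Series x

lemma Dq_comp_nome {g : ℂ → ℂ} {τ : ℂ} (hg : DifferentiableAt ℂ g (nome τ)) :
    Dq (fun t ↦ g (nome t)) τ = nome τ * deriv g (nome τ) / 2 := by
  have h : HasDerivAt (fun t ↦ g (nome t)) _ τ := hg.hasDerivAt.comp τ (hasDerivAt_nome τ)
  rw [Dq, h.deriv]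
  field_simp [Real.pi_ne_zero, I_ne_zero]

lemma ξ₃_eq {τ : ℂ} (hτ : 0 < τ.im) : ξ₃ τ = ξ₃Nome (nome τ) := by
  rw [ξ₃, funext θ₃_eq, Dq_comp_nome (differentiableAt_θ₃Series_nome hτ), ξ₃Nome,
    mul_div_cancel₀ _ two_ne_zero]

lemma ξ₄_eq {τ : ℂ} (hτ : 0 < τ.im) : ξ₄ τ = ξ₃Nome (-nome τ) := by
  rw [← ξ₃_add_one, ξ₃_eq (by simpa using hτ), nome_add_one]

lemma ξ₂_eq {τ : ℂ} (hτ : 0 < τ.im) : ξ₂ τ = ξ₂Nome (nome τ) := by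
  have hd := differentiableOn_θ₂Series.differentiableAt
    (Metric.isOpen_ball.mem_nhds (nome_mem_ball hτ))
  have h1 : HasDerivAt (fun t ↦ cexp (Real.pi * I * t / 4))
      (cexp (Real.pi * I * τ / 4) * (Real.pi * I / 4)) τ := by
    have := (((hasDerivAt_id τ).const_mul (Real.pi * I)).div_const 4).cexp
    simpa using this
  have h2 : HasDerivAt (fun t ↦ cexp (Real.pi * I * t / 4) * θ₂Series (nome t)) _ τ :=
    h1.mul (hd.hasDerivAt.comp τ (hasDerivAt_nome τ))
  have h0 := θ₂_ne_zero hτ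
  rw [ξ₂, Dq, funext θ₂_eq, h2.deriv, ξ₂Nome]
  rw [θ₂_eq] at h0
  have := left_ne_zero_of_mul h0
  have := right_ne_zero_of_mul h0
  field_simp [Real.pi_ne_zero, I_ne_zero]

/-- Halphen defect in terms of the nome. -/
noncomputable def halphenDefectNome (a b c : ℂ → ℂ) (x : ℂ) : ℂ :=
  x * deriv a x / 2 - (a x * b x + a x * c x - b x * c x)

lemma halphenDefect_eq_nome {a b c A B C : ℂ → ℂ} (ha : ∀ τ : ℂ, 0 < τ.im → a τ = A (nome τ))
    (hb : ∀ τ : ℂ, 0 < τ.im → b τ = B (nome τ)) (hc : ∀ τ : ℂ, 0 < τ.im → c τ = C (nome τ))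
    {τ : ℂ} (hA : DifferentiableAt ℂ A (nome τ)) (hτ : 0 < τ.im) :
    halphenDefect a b c τ = halphenDefectNome A B C (nome τ) := by
  have : Dq a τ = Dq (fun t ↦ A (nome t)) τ := by
    rw [Dq, Dq, Filter.EventuallyEq.deriv_eq ((eventually_im_pos hτ).mono ha)]
  rw [halphenDefect, this, Dq_comp_nome hA, ha τ hτ, hb τ hτ, hc τ hτ, halphenDefectNome]

lemma analyticAt_halphenDefectNome {a b c : ℂ → ℂ} {x : ℂ} (ha : AnalyticAt ℂ a x)
    (hb : AnalyticAt ℂ b x) (hc : AnalyticAt ℂ c x) :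
    AnalyticAt ℂ (halphenDefectNome a b c) x :=
  ((analyticAt_id.mul ha.deriv).div_const).sub (((ha.mul hb).add (ha.mul hc)).sub (hb.mul hc))

lemma analyticAt_θ₂Series {x : ℂ} (hx : x ∈ Metric.ball (0 : ℂ) 1) : AnalyticAt ℂ θ₂Series x :=
  differentiableOn_θ₂Series.analyticAt (Metric.isOpen_ball.mem_nhds hx)

lemma analyticAt_θ₃Series {x : ℂ} (hx : x ∈ Metric.ball (0 : ℂ) 1) : AnalyticAt ℂ θ₃Series x :=
  differentiableOn_θ₃Series.analyticAt (Metric.isOpen_ball.mem_nhds hx)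

lemma analyticAt_ξ₂Nome {x : ℂ} (hx : x ∈ Metric.ball (0 : ℂ) 1) (h0 : θ₂Series x ≠ 0) :
    AnalyticAt ℂ ξ₂Nome x :=
  analyticAt_const.add ((analyticAt_id.mul (analyticAt_θ₂Series hx).deriv).div
    (analyticAt_θ₂Series hx) h0)

lemma analyticAt_ξ₃Nome {x : ℂ} (hx : x ∈ Metric.ball (0 : ℂ) 1) (h0 : θ₃Series x ≠ 0) :
    AnalyticAt ℂ ξ₃Nome x :=
  (analyticAt_id.mul (analyticAt_θ₃Series hx).deriv).div (analyticAt_θ₃Series hx) h0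

lemma analyticAt_ξ₃Nome_neg {x : ℂ} (hx : -x ∈ Metric.ball (0 : ℂ) 1) (h0 : θ₃Series (-x) ≠ 0) :
    AnalyticAt ℂ (fun x ↦ ξ₃Nome (-x)) x :=
  AnalyticAt.fun_comp (g := ξ₃Nome) (analyticAt_ξ₃Nome hx h0) analyticAt_id.neg

lemma neg_nome_mem_ball {τ : ℂ} (hτ : 0 < τ.im) : -nome τ ∈ Metric.ball (0 : ℂ) 1 := by
  simpa using nome_mem_ball hτ

/-- Each Halphen defect is `x G(x)` in the nome `x`, with `G` continuous at `0`. -/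
lemma exists_eq_nome_mul {a b c A B C : ℂ → ℂ} (ha : ∀ τ : ℂ, 0 < τ.im → a τ = A (nome τ))
    (hb : ∀ τ : ℂ, 0 < τ.im → b τ = B (nome τ)) (hc : ∀ τ : ℂ, 0 < τ.im → c τ = C (nome τ))
    (hA : ∀ τ : ℂ, 0 < τ.im → AnalyticAt ℂ A (nome τ)) (hA0 : AnalyticAt ℂ A 0)
    (hB0 : AnalyticAt ℂ B 0) (hC0 : AnalyticAt ℂ C 0) (h0 : A 0 * B 0 + A 0 * C 0 = B 0 * C 0) :
    ∃ G : ℂ → ℂ, ContinuousAt G 0 ∧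
      ∀ τ : ℂ, 0 < τ.im → halphenDefect a b c τ = nome τ * G (nome τ) := by
  refine ⟨dslope (halphenDefectNome A B C) 0, continuousAt_dslope_same.mpr
    (analyticAt_halphenDefectNome hA0 hB0 hC0).differentiableAt, fun τ hτ ↦ ?_⟩
  have h := sub_smul_dslope (halphenDefectNome A B C) 0 (nome τ)
  have hz : halphenDefectNome A B C 0 = 0 := by simp [halphenDefectNome, h0]
  rw [hz, sub_zero, sub_zero, smul_eq_mul] at h
  rw [h, halphenDefect_eq_nome ha hb hc (hA τ hτ).differentiableAt hτ]

lemma halphenDefect_eq_zero {τ : ℂ} (hτ : 0 < τ.im) :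
    halphenDefect ξ₂ ξ₃ ξ₄ τ = 0 ∧ halphenDefect ξ₃ ξ₂ ξ₄ τ = 0 ∧
      halphenDefect ξ₄ ξ₂ ξ₃ τ = 0 := by
  have hmem : (0 : ℂ) ∈ Metric.ball (0 : ℂ) 1 := Metric.mem_ball_self one_pos
  have a2 (τ : ℂ) (hτ : 0 < τ.im) : AnalyticAt ℂ ξ₂Nome (nome τ) :=
    analyticAt_ξ₂Nome (nome_mem_ball hτ) (right_ne_zero_of_mul (θ₂_eq τ ▸ θ₂_ne_zero hτ))
  have a3 (τ : ℂ) (hτ : 0 < τ.im) : AnalyticAt ℂ ξ₃Nome (nome τ) :=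
    analyticAt_ξ₃Nome (nome_mem_ball hτ) (θ₃_eq τ ▸ θ₃_ne_zero hτ)
  have a4 (τ : ℂ) (hτ : 0 < τ.im) : AnalyticAt ℂ (fun x ↦ ξ₃Nome (-x)) (nome τ) :=
    analyticAt_ξ₃Nome_neg (neg_nome_mem_ball hτ) (θ₄_eq τ ▸ θ₄_ne_zero hτ)
  have b2 : AnalyticAt ℂ ξ₂Nome 0 := analyticAt_ξ₂Nome hmem (by simp [θ₂Series_zero])
  have b3 : AnalyticAt ℂ ξ₃Nome 0 := analyticAt_ξ₃Nome hmem (by simp [θ₃Series_zero])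
  have b4 : AnalyticAt ℂ (fun x ↦ ξ₃Nome (-x)) 0 :=
    analyticAt_ξ₃Nome_neg (by simp) (by simp [θ₃Series_zero])
  have z3 : ξ₃Nome 0 = 0 := by simp [ξ₃Nome]
  obtain ⟨G2, c2, g2⟩ := exists_eq_nome_mul (fun _ ↦ ξ₂_eq) (fun _ ↦ ξ₃_eq) (fun _ ↦ ξ₄_eq)
    a2 b2 b3 b4 (by simp [z3])
  obtain ⟨G3, c3, g3⟩ := exists_eq_nome_mul (fun _ ↦ ξ₃_eq) (fun _ ↦ ξ₂_eq) (fun _ ↦ ξ₄_eq)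
    a3 b3 b2 b4 (by simp [z3])
  obtain ⟨G4, c4, g4⟩ := exists_eq_nome_mul (fun _ ↦ ξ₄_eq) (fun _ ↦ ξ₂_eq) (fun _ ↦ ξ₃_eq)
    a4 b4 b2 b3 (by simp [z3])
  have d2 (τ : ℂ) (hτ : 0 < τ.im) : DifferentiableAt ℂ (halphenDefect ξ₂ ξ₃ ξ₄) τ :=
    differentiableAt_halphenDefect (fun _ ↦ differentiableAt_ξ₂) (fun _ ↦ differentiableAt_ξ₃)
      (fun _ ↦ differentiableAt_ξ₄) hτ
  have d3 (τ : ℂ) (hτ : 0 < τ.im) : DifferentiableAt ℂ (halphenDefect ξ₃ ξ₂ ξ₄) τ :=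
    differentiableAt_halphenDefect (fun _ ↦ differentiableAt_ξ₃) (fun _ ↦ differentiableAt_ξ₂)
      (fun _ ↦ differentiableAt_ξ₄) hτ
  have d4 (τ : ℂ) (hτ : 0 < τ.im) : DifferentiableAt ℂ (halphenDefect ξ₄ ξ₂ ξ₃) τ :=
    differentiableAt_halphenDefect (fun _ ↦ differentiableAt_ξ₄) (fun _ ↦ differentiableAt_ξ₂)
      (fun _ ↦ differentiableAt_ξ₃) hτ
  have t2 (τ : ℂ) : halphenDefect ξ₂ ξ₃ ξ₄ (τ + 1) = halphenDefect ξ₂ ξ₃ ξ₄ τ := by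
    rw [halphenDefect_add_one ξ₂_add_one ξ₃_add_one ξ₄_add_one, halphenDefect_comm]
  have t3 (τ : ℂ) : halphenDefect ξ₃ ξ₂ ξ₄ (τ + 1) = halphenDefect ξ₄ ξ₂ ξ₃ τ :=
    halphenDefect_add_one ξ₃_add_one ξ₂_add_one ξ₄_add_one τ
  have t4 (τ : ℂ) : halphenDefect ξ₄ ξ₂ ξ₃ (τ + 1) = halphenDefect ξ₃ ξ₂ ξ₄ τ :=
    halphenDefect_add_one ξ₄_add_one ξ₂_add_one ξ₃_add_one τ
  have s2 (τ : ℂ) (hτ : 0 < τ.im) :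
      halphenDefect ξ₂ ξ₃ ξ₄ (-1 / τ) = τ ^ 4 * halphenDefect ξ₄ ξ₂ ξ₃ τ := by
    rw [halphenDefect_neg_one_div (fun _ ↦ ξ₂_neg_one_div) (fun _ ↦ ξ₃_neg_one_div)
      (fun _ ↦ ξ₄_neg_one_div) (fun _ ↦ differentiableAt_ξ₂) (fun _ ↦ differentiableAt_ξ₄) hτ,
      halphenDefect_comm]
  have s3 (τ : ℂ) (hτ : 0 < τ.im) :
      halphenDefect ξ₃ ξ₂ ξ₄ (-1 / τ) = τ ^ 4 * halphenDefect ξ₃ ξ₂ ξ₄ τ := by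
    rw [halphenDefect_neg_one_div (fun _ ↦ ξ₃_neg_one_div) (fun _ ↦ ξ₂_neg_one_div)
      (fun _ ↦ ξ₄_neg_one_div) (fun _ ↦ differentiableAt_ξ₃) (fun _ ↦ differentiableAt_ξ₃) hτ,
      halphenDefect_comm]
  have s4 (τ : ℂ) (hτ : 0 < τ.im) :
      halphenDefect ξ₄ ξ₂ ξ₃ (-1 / τ) = τ ^ 4 * halphenDefect ξ₂ ξ₃ ξ₄ τ := by
    rw [halphenDefect_neg_one_div (fun _ ↦ ξ₄_neg_one_div) (fun _ ↦ ξ₂_neg_one_div)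
      (fun _ ↦ ξ₃_neg_one_div) (fun _ ↦ differentiableAt_ξ₄) (fun _ ↦ differentiableAt_ξ₂) hτ,
      halphenDefect_comm]
  have lim {f G : ℂ → ℂ} (hG : ContinuousAt G 0)
      (h : ∀ τ : ℂ, 0 < τ.im → f τ = nome τ * G (nome τ)) :
      Tendsto (fun τ : ℍ ↦ f τ) atImInfty (𝓝 0) := by
    have := tendsto_nome_atImInfty.mul (hG.tendsto.comp tendsto_nome_atImInfty)
    rw [zero_mul] at this
    exact this.congr fun τ ↦ (h τ τ.2).symm
  have l2 := lim c2 g2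
  have l3 := lim c3 g3
  have l4 := lim c4 g4
  generalize halphenDefect ξ₂ ξ₃ ξ₄ = u at *
  generalize halphenDefect ξ₃ ξ₂ ξ₄ = v at *
  generalize halphenDefect ξ₄ ξ₂ ξ₃ = w at *
  have e1 : u τ + v τ + w τ = 0 := by
    refine eq_zero_of_levelOne_of_weight_lt_twelve (k := 4) (by norm_num)
      (f := fun τ ↦ u τ + v τ + w τ) (fun τ hτ ↦ ((d2 τ hτ).add (d3 τ hτ)).add (d4 τ hτ))
      (fun τ _ ↦ ?_) (fun τ hτ ↦ ?_) ?_ hτ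
    · simp only [t2, t3, t4]; ring
    · simp only [s2 τ hτ, s3 τ hτ, s4 τ hτ, zpow_ofNat]; ring
    · simpa using (l2.add l3).add l4
  have e2 : u τ * v τ + u τ * w τ + v τ * w τ = 0 := by
    refine eq_zero_of_levelOne_of_weight_lt_twelve (k := 8) (by norm_num)
      (f := fun τ ↦ u τ * v τ + u τ * w τ + v τ * w τ)
      (fun τ hτ ↦ (((d2 τ hτ).mul (d3 τ hτ)).add ((d2 τ hτ).mul (d4 τ hτ))).add
        ((d3 τ hτ).mul (d4 τ hτ)))
      (fun τ _ ↦ ?_) (fun τ hτ ↦ ?_) ?_ hτ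
    · simp only [t2, t3, t4]; ring
    · simp only [s2 τ hτ, s3 τ hτ, s4 τ hτ, zpow_ofNat]; ring
    · simpa using ((l2.mul l3).add (l2.mul l4)).add (l3.mul l4)
  have e3 : u τ * v τ * w τ = 0 := by
    have := eq_smul_discriminant_of_levelOne (f := fun τ ↦ u τ * v τ * w τ)
      (φ := fun x ↦ x * (G2 x * G3 x * G4 x))
      (fun τ hτ ↦ ((d2 τ hτ).mul (d3 τ hτ)).mul (d4 τ hτ))
      (fun τ _ ↦ by simp only [t2, t3, t4]; ring)
      (fun τ hτ ↦ by simp only [s2 τ hτ, s3 τ hτ, s4 τ hτ]; ring)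
      (continuousAt_id.mul ((c2.mul c3).mul c4))
      (fun τ hτ ↦ by simp only [g2 τ hτ, g3 τ hτ, g4 τ hτ]; ring) ⟨τ, hτ⟩
    simpa using this
  refine ⟨pow_eq_zero_iff three_ne_zero |>.mp ?_, pow_eq_zero_iff three_ne_zero |>.mp ?_,
    pow_eq_zero_iff three_ne_zero |>.mp ?_⟩
  · linear_combination u τ ^ 2 * e1 - u τ * e2 + e3
  · linear_combination v τ ^ 2 * e1 - v τ * e2 + e3
  · linear_combination w τ ^ 2 * e1 - w τ * e2 + e3

end

/-- Halphen's system of differential equations for `ξ₂, ξ₃, ξ₄` on `ℍ`. -/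
theorem halphen_equations (τ : ℂ) (hτ : 0 < τ.im) :
    Dq ξ₂ τ = ξ₂ τ * ξ₃ τ + ξ₂ τ * ξ₄ τ - ξ₃ τ * ξ₄ τ ∧
    Dq ξ₃ τ = ξ₂ τ * ξ₃ τ - ξ₂ τ * ξ₄ τ + ξ₃ τ * ξ₄ τ ∧
    Dq ξ₄ τ = -(ξ₂ τ * ξ₃ τ) + ξ₂ τ * ξ₄ τ + ξ₃ τ * ξ₄ τ := by
  obtain ⟨h2, h3, h4⟩ := halphenDefect_eq_zero hτ
  simp only [halphenDefect] at h2 h3 h4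
  refine ⟨?_, ?_, ?_⟩
  · linear_combination h2
  · linear_combination h3
  · linear_combination h4
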